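/- arXiv:1908.11544 — 17 statements merged into one kernel-verified Lean document; each statement's English description precedes it below -/
import Mathlib

section
/- Let a : ℕ → ℝ be the sequence with a(1) = 0, a(2) = 1/3, and satisfying the recurrence (n+1)·a(n) = 2·a(n-1) + (n-1)·(a(n-2) + 1) for all n ≥ 3 (this is the average genus of the bouquet of circles B_n). Then for every n ≥ 1, a(n) = (n+1)/2 − Σ_{m=0}^{n-1} (1+(−1)^m)/(2(m+1)) − (1+(−1)^n)/(4(n+1)). -/
open Finset

theorem bouquet_average_genus_formula
    (a : ℕ → ℝ) (ha1 : a 1 = 0) (ha2 : a 2 = 1/3)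
    (hrec : ∀ n : ℕ, 3 ≤ n →
      ((n : ℝ) + 1) * a n = 2 * a (n - 1) + ((n : ℝ) - 1) * (a (n - 2) + 1)) :
    ∀ n : ℕ, 1 ≤ n →
      a n = ((n : ℝ) + 1) / 2
        - ∑ m ∈ Finset.range n, (1 + (-1 : ℝ) ^ m) / (2 * ((m : ℝ) + 1))
        - (1 + (-1 : ℝ) ^ n) / (4 * ((n : ℝ) + 1)) := by
  intro n
  induction n using Nat.twoStepInduction with
  | zero => intro h; omega
  | one => intro _; norm_num [ha1]
  | more k ih₀ ih₁ =>
    intro _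
    rcases Nat.eq_zero_or_pos k with rfl | hk
    · norm_num [ha2, Finset.sum_range_succ]
    · have h := hrec (k + 2) (by omega)
      rw [show k + 2 - 1 = k + 1 by omega, Nat.add_sub_cancel, ih₀ hk, ih₁ (by omega)] at h
      have hpos : ((k + 2 : ℕ) : ℝ) + 1 ≠ 0 := by positivity
      apply mul_left_cancel₀ hpos
      rw [h]
      simp only [Finset.sum_range_succ, pow_succ]
      push_cast
      have h₁ : (k : ℝ) + 1 ≠ 0 := by positivity
      have h₂ : (k : ℝ) + 1 + 1 ≠ 0 := by positivity
      have h₃ : (k : ℝ) + 2 + 1 ≠ 0 := by positivity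
      field_simp
      ring
end

section
/- Let a : ℕ → ℝ be the sequence with a(1) = 0, a(2) = 1/3, and satisfying the recurrence (n+1)·a(n) = 2·a(n-1) + (n-1)·(a(n-2) + 1) for all n ≥ 3. Then a(n) − (n − ln n − c + 1 − ln 2)/2 tends to 0 as n → ∞, where c is the Euler–Mascheroni constant. -/
open Filter

/-- The harmonic numbers satisfy `H (2m + 1) - H m → log 2`. -/
theorem tendsto_harmonic_two_mul_add_one_sub_harmonic :
    Tendsto (fun m : ℕ => (harmonic (2 * m + 1) : ℝ) - harmonic m) atTop
      (nhds (Real.log 2)) := by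
  have hE := Real.tendsto_harmonic_sub_log
  have h2 : Tendsto (fun m : ℕ => 2 * m) atTop atTop :=
    tendsto_id.const_mul_atTop' (by norm_num)
  have hinv : Tendsto (fun m : ℕ => (1 : ℝ) / ((2 * m : ℕ) + 1)) atTop (nhds 0) :=
    tendsto_one_div_add_atTop_nhds_zero_nat.comp h2
  have hlim := (((hE.comp h2).sub hE).add hinv).add_const (Real.log 2)
  rw [sub_self, zero_add, zero_add] at hlim
  refine hlim.congr' ?_
  filter_upwards [eventually_gt_atTop 0] with m hm
  have hm' : (m : ℝ) ≠ 0 := by positivity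
  simp only [Function.comp_apply, harmonic_succ]
  push_cast
  rw [Real.log_mul two_ne_zero hm', one_div]
  ring

/-- Closed form of the average genus of the bouquet of `n` circles in terms of harmonic numbers,
at consecutive odd and even indices. -/
theorem bouquet_average_genus_odd_and_even
    (a : ℕ → ℝ) (ha1 : a 1 = 0) (ha2 : a 2 = 1/3)
    (hrec : ∀ n : ℕ, 3 ≤ n →
      ((n : ℝ) + 1) * a n = 2 * a (n - 1) + ((n : ℝ) - 1) * (a (n - 2) + 1)) (m : ℕ) :
    a (2 * m + 1) =
        (2 * m + 2 - harmonic (2 * m + 1) - (harmonic (2 * m + 1) - harmonic m)) / 2 ∧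
      a (2 * m + 2) =
        (2 * m + 3 - harmonic (2 * m + 2) - (harmonic (2 * m + 3) - harmonic (m + 1))) / 2 := by
  induction m with
  | zero => norm_num [ha1, ha2, harmonic, Finset.sum_range_succ]
  | succ m ih =>
    obtain ⟨hodd, heven⟩ := ih
    have hrec₃ := hrec (2 * m + 3) (by lia)
    have hrec₄ := hrec (2 * m + 4) (by lia)
    simp only [show 2 * m + 3 - 1 = 2 * m + 2 by lia, show 2 * m + 3 - 2 = 2 * m + 1 by lia,
      show 2 * m + 4 - 1 = 2 * m + 3 by lia, show 2 * m + 4 - 2 = 2 * m + 2 by lia]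
      at hrec₃ hrec₄
    rw [show 2 * (m + 1) + 1 = 2 * m + 3 by ring, show 2 * (m + 1) + 2 = 2 * m + 4 by ring,
      show 2 * (m + 1) + 3 = 2 * m + 5 by ring]
    simp only [harmonic_succ] at hodd heven ⊢
    push_cast at hodd heven hrec₃ hrec₄ ⊢
    have hthree : a (2 * m + 3) = _ :=
      eq_div_of_mul_eq (by positivity) ((mul_comm _ _).trans hrec₃)
    have hfour : a (2 * m + 4) = _ :=
      eq_div_of_mul_eq (by positivity) ((mul_comm _ _).trans hrec₄)
    rw [hfour, hthree, heven, hodd]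
    constructor
    · field_simp
      ring
    · field_simp
      ring

/-- Closed form of the average genus of the bouquet of `n` circles in terms of harmonic numbers. -/
theorem bouquet_average_genus_eq_harmonic
    (a : ℕ → ℝ) (ha1 : a 1 = 0) (ha2 : a 2 = 1/3)
    (hrec : ∀ n : ℕ, 3 ≤ n →
      ((n : ℝ) + 1) * a n = 2 * a (n - 1) + ((n : ℝ) - 1) * (a (n - 2) + 1))
    (n : ℕ) (hn : 1 ≤ n) :
    a n = (n + 1 - harmonic n - (harmonic (2 * (n / 2) + 1) - harmonic (n / 2))) / 2 := by
  obtain ⟨m, rfl | rfl⟩ : ∃ m, n = 2 * m + 1 ∨ n = 2 * m + 2 := ⟨(n - 1) / 2, by lia⟩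
  · rw [(bouquet_average_genus_odd_and_even a ha1 ha2 hrec m).1,
      show (2 * m + 1) / 2 = m by lia]
    push_cast
    ring
  · rw [(bouquet_average_genus_odd_and_even a ha1 ha2 hrec m).2,
      show (2 * m + 2) / 2 = m + 1 by lia, show 2 * (m + 1) + 1 = 2 * m + 3 by ring]
    push_cast
    ring

theorem bouquet_average_genus_asymptotic
    (a : ℕ → ℝ) (ha1 : a 1 = 0) (ha2 : a 2 = 1/3)
    (hrec : ∀ n : ℕ, 3 ≤ n →
      ((n : ℝ) + 1) * a n = 2 * a (n - 1) + ((n : ℝ) - 1) * (a (n - 2) + 1)) :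
    Tendsto (fun n : ℕ =>
        a n - ((n : ℝ) - Real.log n - Real.eulerMascheroniConstant + 1 - Real.log 2) / 2)
      atTop (nhds 0) := by
  have hhalf := tendsto_harmonic_two_mul_add_one_sub_harmonic.comp
    (Nat.tendsto_div_const_atTop two_ne_zero)
  have hlim := ((Real.tendsto_harmonic_sub_log.add hhalf).const_sub
    (Real.eulerMascheroniConstant + Real.log 2)).div_const 2
  rw [sub_self, zero_div] at hlim
  refine hlim.congr' ?_
  filter_upwards [eventually_ge_atTop 1] with n hn
  rw [bouquet_average_genus_eq_harmonic a ha1 ha2 hrec n hn]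
  simp only [Function.comp_apply]
  ring
end

section
/- Let a : ℕ → ℝ be the sequence with a(1) = 0, a(2) = 1/3, and satisfying the recurrence (n+1)·a(n) = 2·a(n-1) + (n-1)·(a(n-2) + 1) for all n ≥ 3. Then a(n) − ((n+1)/2 − (1/2)·Σ_{k=1}^{2n} 1/k) tends to 0 as n → ∞. -/
open Filter Finset

/-- A sequence converges as soon as its odd-indexed and positive even-indexed terms converge to the
same limit. -/
lemma tendsto_atTop_of_odd_of_even {X : Type*} {f : ℕ → X} {l : Filter X}
    (hodd : Tendsto (fun m => f (2 * m + 1)) atTop l)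
    (heven : Tendsto (fun m => f (2 * m + 2)) atTop l) : Tendsto f atTop l := by
  intro s hs
  obtain ⟨M, hM⟩ := eventually_atTop.1 (hodd hs)
  obtain ⟨N, hN⟩ := eventually_atTop.1 (heven hs)
  refine mem_map.2 (mem_atTop_sets.2 ⟨2 * M + 2 * N + 2, fun n hn => ?_⟩)
  rcases Nat.even_or_odd' n with ⟨k, rfl | rfl⟩
  · obtain ⟨j, rfl⟩ : ∃ j, k = j + 1 := ⟨k - 1, by omega⟩
    exact hN j (by omega)
  · exact hM k (by omega)

lemma sum_Icc_one_div_eq_harmonic (n : ℕ) :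
    ∑ k ∈ Finset.Icc 1 n, (1 : ℝ) / k = harmonic n := by
  induction n with
  | zero => simp
  | succ n ih => rw [Finset.sum_Icc_succ_top (by omega), ih, harmonic_succ]; push_cast; simp

/-- Closed form of the average genus of bouquets in terms of harmonic numbers. -/
lemma bouquet_average_genus_closed_form
    (a : ℕ → ℝ) (ha1 : a 1 = 0) (ha2 : a 2 = 1/3)
    (hrec : ∀ n : ℕ, 3 ≤ n →
      ((n : ℝ) + 1) * a n = 2 * a (n - 1) + ((n : ℝ) - 1) * (a (n - 2) + 1)) (m : ℕ) :
    a (2 * m + 1) = m + 1 - (harmonic (2 * m + 1) - harmonic m / 2) ∧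
    a (2 * m + 2) = m + 3 / 2 - (harmonic (2 * m + 2) - harmonic (m + 1) / 2)
      - 1 / (2 * (2 * m + 3)) := by
  induction m with
  | zero => norm_num [ha1, ha2, harmonic_succ]
  | succ m ih =>
    obtain ⟨h1, h2⟩ := ih
    have hodd : a (2 * (m + 1) + 1) =
        (m + 1 : ℕ) + 1 - (harmonic (2 * (m + 1) + 1) - harmonic (m + 1) / 2) := by
      have h := hrec (2 * m + 3) (by omega)
      rw [show 2 * m + 3 - 1 = 2 * m + 2 by omega, show 2 * m + 3 - 2 = 2 * m + 1 by omega,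
        h1, h2] at h
      rw [show 2 * (m + 1) + 1 = 2 * m + 3 by ring]
      have hpos : ((2 * m + 3 : ℕ) : ℝ) + 1 ≠ 0 := by positivity
      apply mul_left_cancel₀ hpos
      rw [h]
      simp only [harmonic_succ]
      push_cast
      field_simp
      ring
    refine ⟨hodd, ?_⟩
    have h := hrec (2 * m + 4) (by omega)
    rw [show 2 * m + 4 - 1 = 2 * (m + 1) + 1 by omega, show 2 * m + 4 - 2 = 2 * m + 2 by omega,
      hodd, h2] at h
    rw [show 2 * (m + 1) + 2 = 2 * m + 4 by ring]
    have hpos : ((2 * m + 4 : ℕ) : ℝ) + 1 ≠ 0 := by positivity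
    apply mul_left_cancel₀ hpos
    rw [h, show 2 * (m + 1) + 1 = 2 * m + 3 by ring]
    simp only [harmonic_succ]
    push_cast
    field_simp
    ring

/-- If `u`, `v`, `w` tend to infinity, the combination `H_u / 2 - H_v + H_w / 2` of harmonic numbers
tends to zero as soon as the same combination of logarithms does. -/
lemma tendsto_harmonic_combination {u v w : ℕ → ℕ} (hu : Tendsto u atTop atTop)
    (hv : Tendsto v atTop atTop) (hw : Tendsto w atTop atTop)
    (hlog : Tendsto (fun m => Real.log (u m) / 2 - Real.log (v m) + Real.log (w m) / 2)
      atTop (nhds 0)) :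
    Tendsto (fun m => (harmonic (u m) : ℝ) / 2 - harmonic (v m) + harmonic (w m) / 2)
      atTop (nhds 0) := by
  have H := Real.tendsto_harmonic_sub_log
  have key := ((((H.comp hu).div_const 2).sub (H.comp hv)).add ((H.comp hw).div_const 2)).add hlog
  convert! key using 2
  · simp only [Function.comp_apply]; ring
  · ring

theorem bouquet_average_genus_stahl_asymptotic
    (a : ℕ → ℝ) (ha1 : a 1 = 0) (ha2 : a 2 = 1/3)
    (hrec : ∀ n : ℕ, 3 ≤ n →
      ((n : ℝ) + 1) * a n = 2 * a (n - 1) + ((n : ℝ) - 1) * (a (n - 2) + 1)) :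
    Tendsto (fun n : ℕ =>
        a n - (((n : ℝ) + 1) / 2 - (1/2) * ∑ k ∈ Finset.Icc 1 (2 * n), (1 : ℝ) / k))
      atTop (nhds 0) := by
  have hclosed := bouquet_average_genus_closed_form a ha1 ha2 hrec
  simp only [sum_Icc_one_div_eq_harmonic]
  have hle (f : ℕ → ℕ) (hf : ∀ m, m ≤ f m) : Tendsto f atTop atTop :=
    tendsto_atTop_mono hf tendsto_id
  refine tendsto_atTop_of_odd_of_even ?_ ?_
  · have key := tendsto_harmonic_combination (hle (fun m => 2 * (2 * m + 1)) fun m => by omega)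
      (hle (fun m => 2 * m + 1) fun m => by omega) tendsto_id ?_
    · refine key.congr fun m => ?_
      rw [(hclosed m).1]
      push_cast
      simp only [id]
      ring
    · have hlim := ((Real.tendsto_log_comp_add_sub_log (1 / 2)).comp
        tendsto_natCast_atTop_atTop).div_const (-2)
      rw [zero_div] at hlim
      refine hlim.congr fun m => ?_
      have hm : (2 * m + 1 : ℝ) = 2 * (m + 1 / 2) := by ring
      have hm' : (m + 1 / 2 : ℝ) ≠ 0 := by positivity
      simp only [Function.comp_apply, id]
      push_cast
      rw [hm, Real.log_mul two_ne_zero (by positivity), Real.log_mul two_ne_zero hm']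
      ring
  · have key := tendsto_harmonic_combination (hle (fun m => 2 * (2 * m + 2)) fun m => by omega)
      (hle (fun m => 2 * m + 2) fun m => by omega) (hle (fun m => m + 1) fun m => by omega) ?_
    · have hinv : Tendsto (fun m : ℕ => 1 / (2 * (2 * (m : ℝ) + 3))) atTop (nhds 0) := by
        refine squeeze_zero (fun m => by positivity) (fun m => ?_)
          tendsto_one_div_add_atTop_nhds_zero_nat
        exact one_div_le_one_div_of_le (by positivity) (by linarith [m.cast_nonneg (α := ℝ)])
      have hsub := key.sub hinv
      rw [sub_zero] at hsub
      refine hsub.congr fun m => ?_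
      rw [(hclosed m).2]
      push_cast
      ring
    · refine tendsto_const_nhds.congr fun m => ?_
      have hm : (2 * m + 2 : ℝ) = 2 * (m + 1) := by ring
      have hm' : (m + 1 : ℝ) ≠ 0 := by positivity
      push_cast
      rw [hm, Real.log_mul two_ne_zero (by positivity), Real.log_mul two_ne_zero hm']
      ring
end

section
/- Let a : ℕ → ℝ be the sequence with a(1) = 0, a(2) = 0, and satisfying the recurrence n(n+2)·a(n+1) = (2n+1)·a(n) + (n²−1)·a(n−1) + n² for all n ≥ 2 (this is the average genus of the dipole D_n). Then for every n ≥ 3, a(n) = Σ_{m=4}^{n+1} [ (4(−1)^m m² + m² − 12(−1)^m m − 5m + 6(−1)^m + 6)·(n−m+2) ] / (2(m−3)(m−2)(m−1)m). -/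
open Finset

/-- The coefficient of `n - m + 2` in the average genus formula; it is the second difference of
the average genus sequence. -/
noncomputable def genusCoeff (m : ℕ) : ℝ :=
  (4 * (-1 : ℝ) ^ m * (m : ℝ) ^ 2 + (m : ℝ) ^ 2 - 12 * (-1 : ℝ) ^ m * (m : ℝ)
      - 5 * (m : ℝ) + 6 * (-1 : ℝ) ^ m + 6)
    / (2 * ((m : ℝ) - 3) * ((m : ℝ) - 2) * ((m : ℝ) - 1) * (m : ℝ))

/-- The closed form of the first difference of the average genus sequence. -/
noncomputable def genusDiff (n : ℕ) : ℝ :=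
  ((n : ℝ) ^ 2 + n + 2 * (-1 : ℝ) ^ n) / (2 * n * (n + 2))

lemma genusDiff_one : genusDiff 1 = 0 := by
  norm_num [genusDiff]

lemma genusDiff_recurrence (k : ℕ) :
    ((k : ℝ) + 2) * (k + 4) * genusDiff (k + 2)
      = -(((k : ℝ) + 2) ^ 2 - 1) * genusDiff (k + 1) + ((k : ℝ) + 2) ^ 2 := by
  unfold genusDiff
  push_cast
  have h1 : (k : ℝ) + 1 ≠ 0 := by positivity
  have h2 : (k : ℝ) + 2 ≠ 0 := by positivity
  have h3 : (k : ℝ) + 1 + 2 ≠ 0 := by positivity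
  have h4 : (k : ℝ) + 2 + 2 ≠ 0 := by positivity
  rw [pow_add, pow_add]
  generalize (-1 : ℝ) ^ k = s
  field_simp
  ring

lemma genusDiff_add_genusCoeff (k : ℕ) :
    genusDiff (k + 1) + genusCoeff (k + 4) = genusDiff (k + 2) := by
  unfold genusDiff genusCoeff
  push_cast
  have h1 : (k : ℝ) + 1 ≠ 0 := by positivity
  have h2 : (k : ℝ) + 2 ≠ 0 := by positivity
  have h3 : (k : ℝ) + 3 ≠ 0 := by positivity
  have h4 : (k : ℝ) + 4 ≠ 0 := by positivity
  rw [show (k : ℝ) + 4 - 3 = k + 1 by ring, show (k : ℝ) + 4 - 2 = k + 2 by ring,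
    show (k : ℝ) + 4 - 1 = k + 3 by ring, show (k : ℝ) + 1 + 2 = k + 3 by ring,
    show (k : ℝ) + 2 + 2 = k + 4 by ring, pow_add, pow_add, pow_add]
  generalize (-1 : ℝ) ^ k = s
  field_simp
  ring

lemma sum_genusCoeff (k : ℕ) : ∑ m ∈ Icc 4 (k + 3), genusCoeff m = genusDiff (k + 1) := by
  induction k with
  | zero => simp [genusDiff_one]
  | succ k ih =>
    rw [show k + 1 + 3 = (k + 3) + 1 by ring, sum_Icc_succ_top (by omega), ih]
    exact genusDiff_add_genusCoeff k

lemma sub_eq_genusDiff {a : ℕ → ℝ} (ha1 : a 1 = 0) (ha2 : a 2 = 0)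
    (hrec : ∀ n : ℕ, 2 ≤ n →
      (n : ℝ) * ((n : ℝ) + 2) * a (n + 1)
        = (2 * (n : ℝ) + 1) * a n + ((n : ℝ) ^ 2 - 1) * a (n - 1) + (n : ℝ) ^ 2) (k : ℕ) :
    a (k + 2) - a (k + 1) = genusDiff (k + 1) := by
  induction k with
  | zero => simp [genusDiff_one, ha1, ha2]
  | succ k ih =>
    have h := hrec (k + 2) (by omega)
    rw [show k + 2 - 1 = k + 1 by omega] at h
    push_cast at h
    have hne : ((k : ℝ) + 2) * (k + 4) ≠ 0 := by positivity
    apply mul_left_cancel₀ hne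
    change _ * (a (k + 2 + 1) - a (k + 2)) = _ * genusDiff (k + 2)
    rw [genusDiff_recurrence, ← ih]
    linear_combination h

lemma eq_sum_genusCoeff {a : ℕ → ℝ} (ha1 : a 1 = 0)
    (hdiff : ∀ k, a (k + 2) - a (k + 1) = genusDiff (k + 1)) (k : ℕ) :
    a (k + 1) = ∑ m ∈ Icc 4 (k + 2), genusCoeff m * ((k : ℝ) + 1 - m + 2) := by
  induction k with
  | zero => simp [ha1]
  | succ k ih =>
    have hsplit : ∑ m ∈ Icc 4 (k + 3), genusCoeff m * (((k + 1 : ℕ) : ℝ) + 1 - m + 2)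
        = ∑ m ∈ Icc 4 (k + 3), genusCoeff m * ((k : ℝ) + 1 - m + 2)
          + ∑ m ∈ Icc 4 (k + 3), genusCoeff m := by
      rw [← sum_add_distrib]
      refine sum_congr rfl fun m _ => ?_
      push_cast
      ring
    have hlast : ∑ m ∈ Icc 4 (k + 3), genusCoeff m * ((k : ℝ) + 1 - m + 2)
        = ∑ m ∈ Icc 4 (k + 2), genusCoeff m * ((k : ℝ) + 1 - m + 2) := by
      symm
      refine sum_subset (Icc_subset_Icc_right (by omega)) fun m hm hm' => ?_
      obtain rfl : m = k + 3 := by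
        simp only [mem_Icc] at hm hm'
        omega
      push_cast
      ring
    rw [show k + 1 + 2 = k + 3 by ring, hsplit, hlast, sum_genusCoeff, ← ih, ← hdiff k]
    ring

theorem dipole_average_genus_formula
    (a : ℕ → ℝ) (ha1 : a 1 = 0) (ha2 : a 2 = 0)
    (hrec : ∀ n : ℕ, 2 ≤ n →
      (n : ℝ) * ((n : ℝ) + 2) * a (n + 1)
        = (2 * (n : ℝ) + 1) * a n + ((n : ℝ) ^ 2 - 1) * a (n - 1) + (n : ℝ) ^ 2) :
    ∀ n : ℕ, 3 ≤ n →
      a n = ∑ m ∈ Finset.Icc 4 (n + 1),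
        ((4 * (-1 : ℝ) ^ m * (m : ℝ) ^ 2 + (m : ℝ) ^ 2 - 12 * (-1 : ℝ) ^ m * (m : ℝ)
            - 5 * (m : ℝ) + 6 * (-1 : ℝ) ^ m + 6) * ((n : ℝ) - (m : ℝ) + 2))
          / (2 * ((m : ℝ) - 3) * ((m : ℝ) - 2) * ((m : ℝ) - 1) * (m : ℝ)) := by
  intro n hn
  obtain ⟨k, rfl⟩ : ∃ k, n = k + 1 := ⟨n - 1, by omega⟩
  rw [eq_sum_genusCoeff ha1 (sub_eq_genusDiff ha1 ha2 hrec) k]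
  refine sum_congr rfl fun m _ => ?_
  rw [genusCoeff, div_mul_eq_mul_div]
  push_cast
  rfl
end

section
/- Let a : ℕ → ℝ be the sequence with a(1) = 0, a(2) = 0, and satisfying the recurrence n(n+2)·a(n+1) = (2n+1)·a(n) + (n²−1)·a(n−1) + n² for all n ≥ 2. Then a(n) − (n − ln n − c)/2 tends to 0 as n → ∞, where c is the Euler–Mascheroni constant. -/
open Filter

/-- Closed form of the dipole average genus, for odd and even indices. -/
theorem dipole_average_genus_closed_form
    (a : ℕ → ℝ) (ha1 : a 1 = 0) (ha2 : a 2 = 0)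
    (hrec : ∀ n : ℕ, 2 ≤ n →
      (n : ℝ) * ((n : ℝ) + 2) * a (n + 1)
        = (2 * (n : ℝ) + 1) * a n + ((n : ℝ) ^ 2 - 1) * a (n - 1) + (n : ℝ) ^ 2)
    (k : ℕ) :
    a (2 * k + 1) = ((2 * k + 1) - (harmonic (2 * k + 1) : ℝ)
        - 2 * k / ((2 * k + 1) * (2 * k + 2))) / 2 ∧
      a (2 * k + 2) = ((2 * k + 2) - (harmonic (2 * k + 2) : ℝ) - 1 / (2 * k + 2)) / 2 := by
  induction k with
  | zero => norm_num [harmonic, Finset.sum_range_succ, ha1, ha2]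
  | succ k ih =>
    obtain ⟨hodd, heven⟩ := ih
    have hk : (0 : ℝ) ≤ k := k.cast_nonneg
    have hH2 : (harmonic (2 * k + 2) : ℝ) = harmonic (2 * k + 1) + 1 / (2 * k + 2) := by
      rw [harmonic_succ (2 * k + 1)]; push_cast; ring
    have hH3 : (harmonic (2 * k + 3) : ℝ) = harmonic (2 * k + 2) + 1 / (2 * k + 3) := by
      rw [harmonic_succ (2 * k + 2)]; push_cast; ring
    have hH4 : (harmonic (2 * k + 4) : ℝ) = harmonic (2 * k + 3) + 1 / (2 * k + 4) := by
      rw [harmonic_succ (2 * k + 3)]; push_cast; ring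
    have hrec3 := hrec (2 * k + 2) (by omega)
    have hrec4 := hrec (2 * k + 3) (by omega)
    rw [show 2 * k + 2 + 1 = 2 * k + 3 by ring, show 2 * k + 2 - 1 = 2 * k + 1 by omega] at hrec3
    rw [show 2 * k + 3 + 1 = 2 * k + 4 by ring, show 2 * k + 3 - 1 = 2 * k + 2 by omega] at hrec4
    push_cast at hrec3 hrec4
    have hodd' : a (2 * k + 3) = ((2 * k + 3) - (harmonic (2 * k + 3) : ℝ)
        - (2 * k + 2) / ((2 * k + 3) * (2 * k + 4))) / 2 := by
      have hne : ((2 * k + 2) * (2 * k + 2 + 2) : ℝ) ≠ 0 := by positivity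
      apply mul_left_cancel₀ hne
      rw [hrec3, heven, hodd, hH3, hH2]
      field_simp
      ring
    have heven' : a (2 * k + 4) = ((2 * k + 4) - (harmonic (2 * k + 4) : ℝ)
        - 1 / (2 * k + 4)) / 2 := by
      have hne : ((2 * k + 3) * (2 * k + 3 + 2) : ℝ) ≠ 0 := by positivity
      apply mul_left_cancel₀ hne
      rw [hrec4, hodd', heven, hH4, hH3]
      field_simp
      ring
    rw [show 2 * (k + 1) + 1 = 2 * k + 3 by ring, show 2 * (k + 1) + 2 = 2 * k + 4 by ring,
      hodd', heven']
    push_cast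
    constructor <;> ring

/-- The dipole average genus differs from `(n - H_n) / 2` by at most `1 / n`. -/
theorem abs_dipole_average_genus_sub_le
    (a : ℕ → ℝ) (ha1 : a 1 = 0) (ha2 : a 2 = 0)
    (hrec : ∀ n : ℕ, 2 ≤ n →
      (n : ℝ) * ((n : ℝ) + 2) * a (n + 1)
        = (2 * (n : ℝ) + 1) * a n + ((n : ℝ) ^ 2 - 1) * a (n - 1) + (n : ℝ) ^ 2)
    {n : ℕ} (hn : 1 ≤ n) :
    |a n - (n - (harmonic n : ℝ)) / 2| ≤ 1 / n := by
  obtain ⟨k, rfl | rfl⟩ : ∃ k, n = 2 * k + 1 ∨ n = 2 * k + 2 := ⟨(n - 1) / 2, by omega⟩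
  · rw [(dipole_average_genus_closed_form a ha1 ha2 hrec k).1]
    push_cast
    rw [show ∀ x h d : ℝ, (x - h - d) / 2 - (x - h) / 2 = -(d / 2) by intros; ring, abs_neg,
      abs_of_nonneg (by positivity), div_div, div_le_div_iff₀ (by positivity) (by positivity)]
    have hk : (0 : ℝ) ≤ k := k.cast_nonneg
    nlinarith [mul_nonneg hk hk]
  · rw [(dipole_average_genus_closed_form a ha1 ha2 hrec k).2]
    push_cast
    rw [show ∀ x h d : ℝ, (x - h - d) / 2 - (x - h) / 2 = -(d / 2) by intros; ring, abs_neg,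
      abs_of_nonneg (by positivity)]
    exact half_le_self (by positivity)

theorem dipole_average_genus_asymptotic
    (a : ℕ → ℝ) (ha1 : a 1 = 0) (ha2 : a 2 = 0)
    (hrec : ∀ n : ℕ, 2 ≤ n →
      (n : ℝ) * ((n : ℝ) + 2) * a (n + 1)
        = (2 * (n : ℝ) + 1) * a n + ((n : ℝ) ^ 2 - 1) * a (n - 1) + (n : ℝ) ^ 2) :
    Tendsto (fun n : ℕ =>
        a n - ((n : ℝ) - Real.log n - Real.eulerMascheroniConstant) / 2)
      atTop (nhds 0) := by
  have herr : Tendsto (fun n : ℕ => a n - (n - (harmonic n : ℝ)) / 2) atTop (nhds 0) := by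
    refine squeeze_zero_norm' ?_ (tendsto_one_div_atTop_nhds_zero_nat (𝕜 := ℝ))
    filter_upwards [eventually_ge_atTop 1] with n hn
    exact abs_dipole_average_genus_sub_le a ha1 ha2 hrec hn
  have hlog := (Real.tendsto_harmonic_sub_log.sub_const Real.eulerMascheroniConstant).div_const 2
  rw [sub_self, zero_div] at hlog
  have h := herr.sub hlog
  rw [sub_zero] at h
  exact h.congr fun n => by ring
end

section
/- Let a : ℕ → ℝ satisfy a(1) = 0, a(2) = 1/3, and (n+1)·a(n) = 2·a(n-1) + (n-1)·(a(n-2) + 1) for all n ≥ 3. Then a(n)/⌊n/2⌋ tends to 1 as n → ∞. -/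
open Filter

/-- Solutions of this recurrence stay nonnegative and below the harmonic numbers if they start so. -/
theorem nonneg_and_le_harmonic_of_rec (b : ℕ → ℝ) (hb1 : 0 ≤ b 1 ∧ b 1 ≤ harmonic 1)
    (hb2 : 0 ≤ b 2 ∧ b 2 ≤ harmonic 2)
    (hrec : ∀ n : ℕ, ((n : ℝ) + 4) * b (n + 3) = 1 + 2 * b (n + 2) + ((n : ℝ) + 2) * b (n + 1))
    (n : ℕ) : 0 ≤ b (n + 1) ∧ b (n + 1) ≤ harmonic (n + 1) := by
  induction n using Nat.twoStepInduction with
  | zero => exact hb1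
  | one => exact hb2
  | more n ih₁ ih₂ =>
    have hr := hrec n
    have hn : (0 : ℝ) ≤ n := n.cast_nonneg
    constructor
    · have := mul_nonneg (by positivity : (0 : ℝ) ≤ n + 2) ih₁.1
      exact nonneg_of_mul_nonneg_right (by linarith [ih₂.1]) (by positivity : (0 : ℝ) < n + 4)
    · have h₂ : (harmonic (n + 2) : ℝ) = harmonic (n + 1) + ((n : ℝ) + 2)⁻¹ := by
        rw [harmonic_succ (n + 1)]; push_cast; ring
      have h₃ : (harmonic (n + 3) : ℝ) = harmonic (n + 2) + ((n : ℝ) + 3)⁻¹ := by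
        rw [harmonic_succ (n + 2)]; push_cast; ring
      have hm := mul_le_mul_of_nonneg_left ih₁.2 (by positivity : (0 : ℝ) ≤ n + 2)
      have h₄ : ((n : ℝ) + 2) * ((n : ℝ) + 2)⁻¹ = 1 := mul_inv_cancel₀ (by positivity)
      have h₅ : (0 : ℝ) ≤ ((n : ℝ) + 4) * ((n : ℝ) + 3)⁻¹ := by positivity
      refine le_of_mul_le_mul_left ?_ (by positivity : (0 : ℝ) < n + 4)
      have h₆ := ih₂.2
      simp only [Nat.add_assoc, Nat.reduceAdd] at h₆ ⊢
      rw [hr, h₃]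
      rw [h₂] at h₆ ⊢
      linarith

theorem tendsto_harmonic_div_atTop :
    Tendsto (fun n : ℕ => (harmonic n : ℝ) / n) atTop (nhds 0) := by
  have hlog : Tendsto (fun n : ℕ => (1 + Real.log n) / (n : ℝ)) atTop (nhds 0) := by
    have h : Tendsto (fun x : ℝ => Real.log x / x) atTop (nhds 0) :=
      Real.isLittleO_log_id_atTop.tendsto_div_nhds_zero
    simpa [add_div] using
      tendsto_one_div_atTop_nhds_zero_nat.add (h.comp tendsto_natCast_atTop_atTop)
  refine squeeze_zero (fun n => ?_) (fun n => ?_) hlog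
  · have : (0 : ℚ) ≤ harmonic n := Finset.sum_nonneg fun i _ => by positivity
    have : (0 : ℝ) ≤ harmonic n := by exact_mod_cast this
    positivity
  · gcongr
    exact harmonic_le_one_add_log n

theorem tendsto_natCast_div_two_div_atTop :
    Tendsto (fun n : ℕ => ((n / 2 : ℕ) : ℝ) / n) atTop (nhds (1 / 2)) := by
  have h := (tendsto_nat_floor_mul_div_atTop (R := ℝ) (a := 1 / 2) (by norm_num)).comp
    (tendsto_natCast_atTop_atTop (R := ℝ))
  refine h.congr fun n => ?_
  have : ⌊(1 / 2 : ℝ) * n⌋₊ = n / 2 := by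
    rw [← Nat.floor_div_eq_div (K := ℝ)]
    congr 1
    push_cast
    ring
  simp only [Function.comp_apply, this]

theorem bouquet_average_genus_vs_max_genus
    (a : ℕ → ℝ) (ha1 : a 1 = 0) (ha2 : a 2 = 1/3)
    (hrec : ∀ n : ℕ, 3 ≤ n →
      ((n : ℝ) + 1) * a n = 2 * a (n - 1) + ((n : ℝ) - 1) * (a (n - 2) + 1)) :
    Tendsto (fun n : ℕ => a n / (↑(n / 2) : ℝ)) atTop (nhds 1) := by
  have hb := nonneg_and_le_harmonic_of_rec (fun n => (n : ℝ) / 2 - a n)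
    (by norm_num [ha1, harmonic, Finset.sum_range_succ])
    (by norm_num [ha2, harmonic, Finset.sum_range_succ])
    (fun n => by
      have h := hrec (n + 3) (by omega)
      simp only [show n + 3 - 1 = n + 2 by omega, show n + 3 - 2 = n + 1 by omega] at h
      push_cast at h ⊢
      linear_combination -h)
  have hdefect : Tendsto (fun n : ℕ => ((n : ℝ) / 2 - a n) / n) atTop (nhds 0) := by
    refine squeeze_zero' ?_ ?_ tendsto_harmonic_div_atTop
    all_goals
      filter_upwards [eventually_ge_atTop 1] with n hn
      obtain ⟨m, rfl⟩ := Nat.exists_eq_add_of_le' hn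
    · exact div_nonneg (hb m).1 (Nat.cast_nonneg _)
    · exact div_le_div_of_nonneg_right (hb m).2 (Nat.cast_nonneg _)
  have ha : Tendsto (fun n : ℕ => a n / n) atTop (nhds (1 / 2)) := by
    have h := hdefect.const_sub (1 / 2)
    rw [sub_zero] at h
    refine h.congr' ?_
    filter_upwards [eventually_ne_atTop 0] with n hn
    field_simp
    ring
  have h := ha.div tendsto_natCast_div_two_div_atTop (by norm_num)
  rw [div_self (by norm_num)] at h
  refine h.congr' ?_
  filter_upwards [eventually_ne_atTop 0] with n hn
  exact div_div_div_cancel_right₀ (Nat.cast_ne_zero.mpr hn) _ _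
end

section
/- Let a : ℕ → ℝ satisfy a(1) = 0, a(2) = 1/3, a(n) = 0 for n ≤ 0, and (n+1)·a(n) = 2·a(n-1) + (n-1)·(a(n-2) + 1) for all n ≥ 3. Then for every real t with 0 < |t| < 1, the series Σ_{n≥1} a(n)·tⁿ converges and its sum equals [−(t²−1)·ln(1−t) + (t²−1)·ln(1+t) + 2t] / (4(t−1)²·t). -/
/-- The increments of a solution of the average genus recurrence: the `n`-th one is
`m / (2 * m + 1)` with `m = ⌊n / 2⌋`. -/
theorem average_genus_succ_sub
    (a : ℕ → ℝ) (ha0 : a 0 = 0) (ha1 : a 1 = 0) (ha2 : a 2 = 1 / 3)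
    (hrec : ∀ n : ℕ, 3 ≤ n →
      ((n : ℝ) + 1) * a n = 2 * a (n - 1) + ((n : ℝ) - 1) * (a (n - 2) + 1)) (m : ℕ) :
    a (2 * m + 1) - a (2 * m) = m / (2 * m + 1) ∧
      a (2 * m + 2) - a (2 * m + 1) = (m + 1) / (2 * m + 3) := by
  induction m with
  | zero => norm_num [ha0, ha1, ha2]
  | succ m ih =>
    have h₁ := hrec (2 * m + 3) (by lia)
    have h₂ := hrec (2 * m + 4) (by lia)
    simp only [show 2 * m + 3 - 1 = 2 * m + 2 by lia, show 2 * m + 3 - 2 = 2 * m + 1 by lia,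
      show 2 * m + 4 - 1 = 2 * m + 3 by lia, show 2 * m + 4 - 2 = 2 * m + 2 by lia] at h₁ h₂
    push_cast at h₁ h₂ ⊢
    simp only [show 2 * (m + 1) = 2 * m + 2 by lia]
    have hm : (0 : ℝ) ≤ m := m.cast_nonneg
    have hodd : a (2 * m + 3) - a (2 * m + 2) = (m + 1) / (2 * m + 3) := by
      have h : a (2 * m + 1) = a (2 * m + 2) - (m + 1) / (2 * m + 3) := by linarith [ih.2]
      have key : (2 * (m : ℝ) + 4) * (a (2 * m + 3) - a (2 * m + 2))
          = (2 * m + 2) * (1 - (m + 1) / (2 * m + 3)) := by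
        rw [h] at h₁; linear_combination h₁
      apply mul_left_cancel₀ (show 2 * (m : ℝ) + 4 ≠ 0 by positivity)
      rw [key]; field_simp; ring
    constructor
    · rw [hodd]; ring
    · have h : a (2 * m + 2) = a (2 * m + 3) - (m + 1) / (2 * m + 3) := by linarith
      have key : (2 * (m : ℝ) + 5) * (a (2 * m + 4) - a (2 * m + 3))
          = (2 * m + 3) * (1 - (m + 1) / (2 * m + 3)) := by
        rw [h] at h₂; linear_combination h₂
      apply mul_left_cancel₀ (show 2 * (m : ℝ) + 5 ≠ 0 by positivity)
      rw [key]; field_simp; ring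

/-- The average genus as a sum of increments. -/
theorem average_genus_eq_sum
    (a : ℕ → ℝ) (ha0 : a 0 = 0) (ha1 : a 1 = 0) (ha2 : a 2 = 1 / 3)
    (hrec : ∀ n : ℕ, 3 ≤ n →
      ((n : ℝ) + 1) * a n = 2 * a (n - 1) + ((n : ℝ) - 1) * (a (n - 2) + 1)) (n : ℕ) :
    a n = ∑ k ∈ Finset.range (n + 1), ((k / 2 : ℕ) : ℝ) / (2 * (k / 2 : ℕ) + 1) := by
  induction n with
  | zero => simp [ha0]
  | succ n ih =>
    rw [Finset.sum_range_succ, ← ih]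
    rcases Nat.even_or_odd' n with ⟨m, rfl | rfl⟩
    · rw [show (2 * m + 1) / 2 = m by lia]
      linarith [(average_genus_succ_sub a ha0 ha1 ha2 hrec m).1]
    · rw [show (2 * m + 1 + 1) / 2 = m + 1 by lia]
      have h := (average_genus_succ_sub a ha0 ha1 ha2 hrec m).2
      push_cast
      rw [show 2 * ((m : ℝ) + 1) + 1 = 2 * m + 3 by ring]
      linarith

theorem hasSum_div_two_mul_add_one_mul_pow {t : ℝ} (h0 : t ≠ 0) (ht : |t| < 1) :
    HasSum (fun m : ℕ => (m : ℝ) / (2 * m + 1) * t ^ (2 * m))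
      (((1 - t ^ 2)⁻¹ - (Real.log (1 + t) - Real.log (1 - t)) / (2 * t)) / 2) := by
  have hsq : |t ^ 2| < 1 := by rw [abs_pow]; exact pow_lt_one₀ (abs_nonneg t) ht two_ne_zero
  have hlog := (Real.hasSum_log_sub_log_of_abs_lt_one ht).div_const (2 * t)
  refine (((hasSum_geometric_of_abs_lt_one hsq).sub hlog).div_const 2).congr_fun fun m => ?_
  have : (2 * (m : ℝ) + 1) ≠ 0 := by positivity
  rw [← pow_mul]
  field_simp
  ring

theorem hasSum_half_div_mul_pow {t : ℝ} (h0 : t ≠ 0) (ht : |t| < 1) :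
    HasSum (fun k : ℕ => ((k / 2 : ℕ) : ℝ) / (2 * (k / 2 : ℕ) + 1) * t ^ k)
      ((1 + t) *
        (((1 - t ^ 2)⁻¹ - (Real.log (1 + t) - Real.log (1 - t)) / (2 * t)) / 2)) := by
  have h := hasSum_div_two_mul_add_one_mul_pow h0 ht
  rw [add_mul, one_mul]
  refine HasSum.even_add_odd ?_ ?_
  · simpa using h
  · refine (h.mul_left t).congr_fun fun m => ?_
    rw [show (2 * m + 1) / 2 = m by lia]
    ring

theorem bouquet_average_genus_generating_function
    (a : ℕ → ℝ) (ha0 : a 0 = 0) (ha1 : a 1 = 0) (ha2 : a 2 = 1/3)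
    (hrec : ∀ n : ℕ, 3 ≤ n →
      ((n : ℝ) + 1) * a n = 2 * a (n - 1) + ((n : ℝ) - 1) * (a (n - 2) + 1)) :
    ∀ t : ℝ, 0 < |t| → |t| < 1 →
      HasSum (fun n : ℕ => a (n + 1) * t ^ (n + 1))
        ((-(t ^ 2 - 1) * Real.log (1 - t) + (t ^ 2 - 1) * Real.log (1 + t) + 2 * t)
          / (4 * (t - 1) ^ 2 * t)) := by
  intro t htpos ht
  have h0 : t ≠ 0 := abs_pos.mp htpos
  have hinc := hasSum_half_div_mul_pow h0 ht
  have hgeom := hasSum_geometric_of_abs_lt_one ht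
  have hprod := hasSum_sum_range_mul_of_summable_norm hinc.summable.norm hgeom.summable.norm
  rw [hinc.tsum_eq, hgeom.tsum_eq] at hprod
  have hterm : ∀ n : ℕ, ∑ k ∈ Finset.range (n + 1),
      ((k / 2 : ℕ) : ℝ) / (2 * (k / 2 : ℕ) + 1) * t ^ k * t ^ (n - k) = a n * t ^ n := by
    intro n
    rw [average_genus_eq_sum a ha0 ha1 ha2 hrec n, Finset.sum_mul]
    refine Finset.sum_congr rfl fun k hk => ?_
    rw [mul_assoc, ← pow_add, Nat.add_sub_cancel' (Finset.mem_range_succ_iff.mp hk)]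
  simp only [hterm] at hprod
  rw [← hasSum_nat_add_iff' 1] at hprod
  convert! hprod using 1
  obtain ⟨hneg, hlt⟩ := abs_lt.mp ht
  have h₁ : 1 - t ≠ 0 := by linarith
  have h₂ : 1 + t ≠ 0 := by linarith
  rw [show 1 - t ^ 2 = (1 - t) * (1 + t) by ring,
    show (t - 1) ^ 2 = (1 - t) ^ 2 by ring]
  simp only [Finset.sum_range_one, ha0, zero_mul, sub_zero]
  field_simp
  ring
end

section
/- Define u : ℝ → ℝ by u(t) = [−(t²−1)·ln(1−t) + (t²−1)·ln(1+t) + 2t] / (4(t−1)²·t). Then for every t with 0 < t < 1, u is differentiable at t and satisfies u'(t)·(t − t³) + u(t)·(1 − 2t − t²) = t²/(1−t)². -/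
theorem bouquet_generating_function_ode
    (u : ℝ → ℝ)
    (hu : ∀ t : ℝ, u t =
      (-(t ^ 2 - 1) * Real.log (1 - t) + (t ^ 2 - 1) * Real.log (1 + t) + 2 * t)
        / (4 * (t - 1) ^ 2 * t)) :
    ∀ t : ℝ, 0 < t → t < 1 →
      DifferentiableAt ℝ u t ∧
        deriv u t * (t - t ^ 3) + u t * (1 - 2 * t - t ^ 2) = t ^ 2 / (1 - t) ^ 2 := by
  intro t ht0 ht1
  have ht : t ≠ 0 := ht0.ne'
  have hsub : 1 - t ≠ 0 := (sub_pos.2 ht1).ne'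
  have hsub' : t - 1 ≠ 0 := (sub_neg.2 ht1).ne
  have hadd : 1 + t ≠ 0 := by positivity
  have hlog_sub : HasDerivAt (fun x : ℝ => Real.log (1 - x)) (-1 / (1 - t)) t :=
    ((hasDerivAt_id t).const_sub 1).log hsub
  have hlog_add : HasDerivAt (fun x : ℝ => Real.log (1 + x)) (1 / (1 + t)) t :=
    ((hasDerivAt_id t).const_add 1).log hadd
  have hsq : HasDerivAt (fun x : ℝ => x ^ 2 - 1) (2 * t) t := by
    simpa using (hasDerivAt_pow 2 t).sub_const 1
  have hnum : HasDerivAt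
      (fun x : ℝ => -(x ^ 2 - 1) * Real.log (1 - x) + (x ^ 2 - 1) * Real.log (1 + x) + 2 * x)
      (-(2 * t) * (Real.log (1 - t) - Real.log (1 + t))) t := by
    refine (((hsq.fun_neg.fun_mul hlog_sub).fun_add (hsq.fun_mul hlog_add)).fun_add
      ((hasDerivAt_id' t).const_mul 2)).congr_deriv ?_
    field_simp
    ring
  have hden : HasDerivAt (fun x : ℝ => 4 * (x - 1) ^ 2 * x)
      (8 * (t - 1) * t + 4 * (t - 1) ^ 2) t := by
    refine (((((hasDerivAt_id' t).sub_const 1).fun_pow 2).const_mul 4).fun_mul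
      (hasDerivAt_id' t)).congr_deriv ?_
    push_cast
    ring
  have hderiv := hnum.fun_div hden (by positivity)
  rw [← funext hu] at hderiv
  refine ⟨hderiv.differentiableAt, ?_⟩
  rw [hderiv.deriv, hu t, ← neg_sub t 1, neg_sq]
  generalize Real.log (-(t - 1)) = a
  generalize Real.log (1 + t) = b
  field_simp
  ring
end

section
/- Let a : ℕ → ℝ satisfy a(1) = 0, a(2) = 0, and n(n+2)·a(n+1) = (2n+1)·a(n) + (n²−1)·a(n−1) + n² for all n ≥ 2. Define v(t) = −t³ + 2t³·ln(1+t) + 3t² − 2t²·ln(1+t) − 2t·ln(1−t) − 2t·ln(1+t) + 2·ln(1−t) + 2·ln(1+t). Then for every real t with 0 < |t| < 1, the series Σ_{n≥3} a(n)·t^{n−3} converges and its sum equals 1/(4(t−1)t²) + v(t)/(4(t−1)²·t⁴). -/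
/-- The generating function of the harmonic numbers. -/
theorem hasSum_harmonic_mul_pow {t : ℝ} (ht : |t| < 1) :
    HasSum (fun n : ℕ => (harmonic (n + 1) : ℝ) * t ^ (n + 1)) (-Real.log (1 - t) / (1 - t)) := by
  have hlog := Real.hasSum_pow_div_log_of_abs_lt_one ht
  have hgeom := hasSum_geometric_of_norm_lt_one (ξ := t) ht
  have hprod := summable_norm_sum_mul_range_of_summable_norm hlog.summable.norm hgeom.summable.norm
  have htsum := tsum_mul_tsum_eq_tsum_sum_range_of_summable_norm
    hlog.summable.norm hgeom.summable.norm
  rw [hlog.tsum_eq, hgeom.tsum_eq, ← div_eq_mul_inv] at htsum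
  rw [htsum]
  refine hprod.of_norm.hasSum.congr_fun fun n => ?_
  rw [harmonic]
  push_cast
  rw [Finset.sum_mul]
  refine Finset.sum_congr rfl fun k hk => ?_
  have hpow : t ^ (n + 1) = t ^ (k + 1) * t ^ (n - k) := by
    rw [← pow_add]
    congr 1
    have := Finset.mem_range.mp hk
    omega
  rw [hpow]
  ring

/-- The term `m = 0` on the left vanishes because of the convention `1 / 0 = 0`. -/
theorem hasSum_neg_one_pow_mul_pow_div {t : ℝ} (ht : |t| < 1) :
    HasSum (fun m : ℕ => ((-1) ^ (m + 1) / (m : ℝ) + (-1) ^ m / ((m : ℝ) + 1)) * t ^ (m + 1))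
      ((1 + t) * Real.log (1 + t)) := by
  have hlog := (Real.hasSum_pow_div_log_of_abs_lt_one (x := -t) (by rwa [abs_neg])).neg
  rw [neg_neg, sub_neg_eq_add] at hlog
  have hshift : HasSum (fun m : ℕ => (-1) ^ (m + 1) / (m : ℝ) * t ^ (m + 1))
      (t * Real.log (1 + t)) := by
    rw [← hasSum_nat_add_iff' 1]
    simp only [Finset.sum_range_one, Nat.cast_zero, div_zero, zero_mul, sub_zero]
    refine (hlog.mul_left t).congr_fun fun m => ?_
    rw [neg_pow t]
    push_cast
    ring
  rw [add_mul, one_mul, add_comm]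
  refine (hshift.add hlog).congr_fun fun m => ?_
  rw [neg_pow t]
  ring

/-- Closed form of the average genus of the dipole with `n + 1` edges. -/
theorem dipole_average_genus_eq_harmonic
    (a : ℕ → ℝ) (ha1 : a 1 = 0) (ha2 : a 2 = 0)
    (hrec : ∀ n : ℕ, 2 ≤ n →
      (n : ℝ) * ((n : ℝ) + 2) * a (n + 1)
        = (2 * (n : ℝ) + 1) * a n + ((n : ℝ) ^ 2 - 1) * a (n - 1) + (n : ℝ) ^ 2)
    (n : ℕ) :
    a (n + 1) = (((n : ℝ) + 1) - harmonic (n + 2)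
      + ((-1) ^ (n + 2) / ((n : ℝ) + 1) + (-1) ^ (n + 1) / ((n : ℝ) + 2))) / 2 := by
  induction n using Nat.twoStepInduction with
  | zero => norm_num [ha1, harmonic_succ]
  | one => norm_num [ha2, harmonic_succ]
  | more n ih₀ ih₁ =>
    have h := hrec (n + 2) (by omega)
    rw [show n + 2 - 1 = n + 1 by omega, ih₀, show n + 2 = n + 1 + 1 by rfl, ih₁] at h
    have hne : ((n : ℝ) + 2) * ((n : ℝ) + 4) ≠ 0 := by positivity
    refine mul_left_cancel₀ hne ?_
    have h1 : (n : ℝ) + 1 ≠ 0 := by positivity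
    have h2 : (n : ℝ) + 2 ≠ 0 := by positivity
    have h3 : (n : ℝ) + 3 ≠ 0 := by positivity
    have h4 : (n : ℝ) + 4 ≠ 0 := by positivity
    have e2 : (n : ℝ) + 1 + 1 = n + 2 := by ring
    have e3 : (n : ℝ) + 1 + 2 = n + 3 := by ring
    have e4 : (n : ℝ) + 2 + 2 = n + 4 := by ring
    have e5 : (n : ℝ) + 2 + 1 = n + 3 := by ring
    have e6 : (n : ℝ) + 3 + 1 = n + 4 := by ring
    simp only [harmonic_succ (n + 3), harmonic_succ (n + 2), pow_succ] at h ⊢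
    push_cast at h ⊢
    simp only [e2, e3, e4, e5, e6] at h ⊢
    refine Eq.trans ?_ (h.trans ?_)
    · ring
    · field_simp
      ring

theorem dipole_average_genus_generating_function
    (a : ℕ → ℝ) (ha1 : a 1 = 0) (ha2 : a 2 = 0)
    (hrec : ∀ n : ℕ, 2 ≤ n →
      (n : ℝ) * ((n : ℝ) + 2) * a (n + 1)
        = (2 * (n : ℝ) + 1) * a n + ((n : ℝ) ^ 2 - 1) * a (n - 1) + (n : ℝ) ^ 2)
    (v : ℝ → ℝ)
    (hv : ∀ t : ℝ, v t =
      -t ^ 3 + 2 * t ^ 3 * Real.log (1 + t) + 3 * t ^ 2 - 2 * t ^ 2 * Real.log (1 + t)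
        - 2 * t * Real.log (1 - t) - 2 * t * Real.log (1 + t)
        + 2 * Real.log (1 - t) + 2 * Real.log (1 + t)) :
    ∀ t : ℝ, 0 < |t| → |t| < 1 →
      HasSum (fun n : ℕ => a (n + 3) * t ^ n)
        (1 / (4 * (t - 1) * t ^ 2) + v t / (4 * (t - 1) ^ 2 * t ^ 4)) := by
  intro t ht0 ht1
  have htne : t ≠ 0 := abs_pos.mp ht0
  have ht1ne : 1 - t ≠ 0 := by
    have := (abs_lt.mp ht1).2
    linarith
  have hlin := (hasSum_coe_mul_geometric_of_norm_lt_one (r := t) ht1).mul_right t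
  have hsum := (hlin.sub (hasSum_harmonic_mul_pow ht1)).add (hasSum_neg_one_pow_mul_pow_div ht1)
  rw [← hasSum_nat_add_iff' 3] at hsum
  have hclosed : t / (1 - t) ^ 2 * t - -Real.log (1 - t) / (1 - t) + (1 + t) * Real.log (1 + t)
      = 2 * t ^ 4 * (1 / (4 * (t - 1) * t ^ 2) + v t / (4 * (t - 1) ^ 2 * t ^ 4)) := by
    have : t - 1 ≠ 0 := by
      rw [← neg_sub]
      exact neg_ne_zero.mpr ht1ne
    rw [hv, show t / (1 - t) ^ 2 = t / (t - 1) ^ 2 by rw [← neg_sub, neg_sq],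
      show -Real.log (1 - t) / (1 - t) = Real.log (1 - t) / (t - 1) by
        rw [← neg_sub t 1, neg_div_neg_eq]]
    field_simp
    ring
  have hinit : ∑ m ∈ Finset.range 3, ((m : ℝ) * t ^ m * t - harmonic (m + 1) * t ^ (m + 1)
      + ((-1) ^ (m + 1) / (m : ℝ) + (-1) ^ m / ((m : ℝ) + 1)) * t ^ (m + 1)) = 0 := by
    norm_num [Finset.sum_range_succ, harmonic_succ]
    ring
  rw [hinit, sub_zero, hclosed] at hsum
  rw [← hasSum_mul_left_iff (mul_ne_zero two_ne_zero (pow_ne_zero 4 htne))]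
  refine hsum.congr_fun fun n => ?_
  rw [dipole_average_genus_eq_harmonic a ha1 ha2 hrec (n + 2)]
  push_cast
  rw [show (n : ℝ) + 2 + 1 = n + 3 by ring, show (n : ℝ) + 2 + 2 = n + 3 + 1 by ring]
  ring
end

section
/- Define v(t) = −t³ + 2t³·ln(1+t) + 3t² − 2t²·ln(1+t) − 2t·ln(1−t) − 2t·ln(1+t) + 2·ln(1−t) + 2·ln(1+t) and u(t) = 1/(4(t−1)t²) + v(t)/(4(t−1)²·t⁴). Then for every t with 0 < t < 1, u is twice differentiable at t and satisfies (t² − t⁴)·u''(t) + (7t − 2t² − 9t³)·u'(t) + (8 − 7t − 15t²)·u(t) = (3t − 4 − t²)/(t−1)³. -/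
open Real

/-- On `(0, 1)` the generating function simplifies to this expression, which is polynomial in
`t⁻¹`, `(1 - t)⁻¹` and the two logarithms. -/
noncomputable def dipoleGF (t : ℝ) : ℝ :=
  ((1 - t)⁻¹ ^ 2 * t⁻¹ ^ 2 + log (1 + t) * (t⁻¹ ^ 3 + t⁻¹ ^ 4)
    + log (1 - t) * ((1 - t)⁻¹ * t⁻¹ ^ 4)) / 2

/-- The derivative of `dipoleGF` on `(0, 1)`. -/
noncomputable def dipoleGFDeriv (t : ℝ) : ℝ :=
  (2 * (1 - t)⁻¹ ^ 3 * t⁻¹ ^ 2 - 2 * (1 - t)⁻¹ ^ 2 * t⁻¹ ^ 3 + t⁻¹ ^ 4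
    - (1 - t)⁻¹ ^ 2 * t⁻¹ ^ 4 + log (1 + t) * (-3 * t⁻¹ ^ 4 - 4 * t⁻¹ ^ 5)
    + log (1 - t) * ((1 - t)⁻¹ ^ 2 * t⁻¹ ^ 4 - 4 * (1 - t)⁻¹ * t⁻¹ ^ 5)) / 2

/-- The second derivative of `dipoleGF` on `(0, 1)`. -/
noncomputable def dipoleGFDerivTwo (t : ℝ) : ℝ :=
  (6 * (1 - t)⁻¹ ^ 4 * t⁻¹ ^ 2 - 8 * (1 - t)⁻¹ ^ 3 * t⁻¹ ^ 3 + 6 * (1 - t)⁻¹ ^ 2 * t⁻¹ ^ 4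
    - 4 * t⁻¹ ^ 5 - 3 * (1 - t)⁻¹ ^ 3 * t⁻¹ ^ 4 + 8 * (1 - t)⁻¹ ^ 2 * t⁻¹ ^ 5
    + (1 + t)⁻¹ * (-3 * t⁻¹ ^ 4 - 4 * t⁻¹ ^ 5)
    + log (1 + t) * (12 * t⁻¹ ^ 5 + 20 * t⁻¹ ^ 6)
    + log (1 - t) * (2 * (1 - t)⁻¹ ^ 3 * t⁻¹ ^ 4 - 8 * (1 - t)⁻¹ ^ 2 * t⁻¹ ^ 5
      + 20 * (1 - t)⁻¹ * t⁻¹ ^ 6)) / 2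

theorem hasDerivAt_inv_one_sub {t : ℝ} (ht : t < 1) :
    HasDerivAt (fun s : ℝ => (1 - s)⁻¹) ((1 - t)⁻¹ ^ 2) t := by
  simpa [Pi.inv_def] using ((hasDerivAt_id t).const_sub 1).inv (sub_pos.2 ht).ne'

theorem hasDerivAt_inv_neg_sq {t : ℝ} (ht : 0 < t) :
    HasDerivAt (fun s : ℝ => s⁻¹) (-t⁻¹ ^ 2) t := by
  simpa using hasDerivAt_inv ht.ne'

theorem hasDerivAt_log_one_add {t : ℝ} (ht : 0 < t) :
    HasDerivAt (fun s : ℝ => log (1 + s)) (1 + t)⁻¹ t := by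
  simpa using ((hasDerivAt_id t).const_add 1).log (by simp only [id]; positivity)

theorem hasDerivAt_log_one_sub {t : ℝ} (ht : t < 1) :
    HasDerivAt (fun s : ℝ => log (1 - s)) (-(1 - t)⁻¹) t := by
  simpa [neg_div] using ((hasDerivAt_id t).const_sub 1).log (sub_pos.2 ht).ne'

theorem hasDerivAt_dipoleGF {t : ℝ} (h0 : 0 < t) (h1 : t < 1) :
    HasDerivAt dipoleGF (dipoleGFDeriv t) t := by
  have ha := hasDerivAt_inv_neg_sq h0
  have hb := hasDerivAt_inv_one_sub h1
  have hp := hasDerivAt_log_one_add h0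
  have hm := hasDerivAt_log_one_sub h1
  have h := ((((hb.pow 2).mul (ha.pow 2)).add (hp.mul ((ha.pow 3).add (ha.pow 4)))).add
    (hm.mul (hb.mul (ha.pow 4)))).div_const 2
  refine h.congr_deriv ?_
  have hcancel : (1 + t)⁻¹ * (t⁻¹ ^ 3 + t⁻¹ ^ 4) = t⁻¹ ^ 4 := by field_simp; ring
  simp only [dipoleGFDeriv, Pi.add_apply, Pi.mul_apply, Pi.pow_apply]
  push_cast
  linear_combination hcancel / 2

theorem hasDerivAt_dipoleGFDeriv {t : ℝ} (h0 : 0 < t) (h1 : t < 1) :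
    HasDerivAt dipoleGFDeriv (dipoleGFDerivTwo t) t := by
  have ha := hasDerivAt_inv_neg_sq h0
  have hb := hasDerivAt_inv_one_sub h1
  have hp := hasDerivAt_log_one_add h0
  have hm := hasDerivAt_log_one_sub h1
  have h := (((((((hb.pow 3).const_mul 2).mul (ha.pow 2)).sub
    (((hb.pow 2).const_mul 2).mul (ha.pow 3))).add (ha.pow 4)).sub
    ((hb.pow 2).mul (ha.pow 4))).add
    (hp.mul (((ha.pow 4).const_mul (-3)).sub ((ha.pow 5).const_mul 4)))).add
    (hm.mul (((hb.pow 2).mul (ha.pow 4)).sub ((hb.const_mul 4).mul (ha.pow 5)))) |>.div_const 2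
  refine h.congr_deriv ?_
  simp only [dipoleGFDerivTwo, Pi.sub_apply, Pi.mul_apply, Pi.pow_apply]
  push_cast
  ring

theorem dipoleGF_ode {t : ℝ} (h0 : 0 < t) (h1 : t < 1) :
    (t ^ 2 - t ^ 4) * dipoleGFDerivTwo t + (7 * t - 2 * t ^ 2 - 9 * t ^ 3) * dipoleGFDeriv t
      + (8 - 7 * t - 15 * t ^ 2) * dipoleGF t = (3 * t - 4 - t ^ 2) / (t - 1) ^ 3 := by
  have hs : 1 - t ≠ 0 := (sub_pos.2 h1).ne'
  have hneg : (t - 1) ^ 3 = -(1 - t) ^ 3 := by ring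
  rw [hneg]
  unfold dipoleGFDerivTwo dipoleGFDeriv dipoleGF
  generalize log (1 + t) = p
  generalize log (1 - t) = m
  field_simp
  ring

theorem dipole_generating_function_ode
    (v u : ℝ → ℝ)
    (hv : ∀ t : ℝ, v t =
      -t ^ 3 + 2 * t ^ 3 * Real.log (1 + t) + 3 * t ^ 2 - 2 * t ^ 2 * Real.log (1 + t)
        - 2 * t * Real.log (1 - t) - 2 * t * Real.log (1 + t)
        + 2 * Real.log (1 - t) + 2 * Real.log (1 + t))
    (hu : ∀ t : ℝ, u t = 1 / (4 * (t - 1) * t ^ 2) + v t / (4 * (t - 1) ^ 2 * t ^ 4)) :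
    ∀ t : ℝ, 0 < t → t < 1 →
      DifferentiableAt ℝ u t ∧ DifferentiableAt ℝ (deriv u) t ∧
        (t ^ 2 - t ^ 4) * deriv (deriv u) t + (7 * t - 2 * t ^ 2 - 9 * t ^ 3) * deriv u t
          + (8 - 7 * t - 15 * t ^ 2) * u t = (3 * t - 4 - t ^ 2) / (t - 1) ^ 3 := by
  have heq : Set.EqOn u dipoleGF (Set.Ioo 0 1) := by
    rintro s ⟨hs0, hs1⟩
    have hs : 1 - s ≠ 0 := (sub_pos.2 hs1).ne'
    rw [hu, hv, ← neg_sub 1 s]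
    unfold dipoleGF
    field_simp
    ring
  have hd : ∀ s ∈ Set.Ioo (0 : ℝ) 1, HasDerivAt u (dipoleGFDeriv s) s := fun s hs =>
    (hasDerivAt_dipoleGF hs.1 hs.2).congr_of_eventuallyEq
      (heq.eventuallyEq_of_mem (isOpen_Ioo.mem_nhds hs))
  intro t h0 h1
  have ht : t ∈ Set.Ioo (0 : ℝ) 1 := ⟨h0, h1⟩
  have hderiv : Set.EqOn (deriv u) dipoleGFDeriv (Set.Ioo 0 1) := fun s hs => (hd s hs).deriv
  have hdd : HasDerivAt (deriv u) (dipoleGFDerivTwo t) t :=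
    (hasDerivAt_dipoleGFDeriv h0 h1).congr_of_eventuallyEq
      (hderiv.eventuallyEq_of_mem (isOpen_Ioo.mem_nhds ht))
  refine ⟨(hd t ht).differentiableAt, hdd.differentiableAt, ?_⟩
  rw [hdd.deriv, hderiv ht, heq ht]
  exact dipoleGF_ode h0 h1
end

section
/- Define v(t) = −t³ + 2t³·ln(1+t) + 3t² − 2t²·ln(1+t) − 2t·ln(1−t) − 2t·ln(1+t) + 2·ln(1−t) + 2·ln(1+t). Then for every real t with |t| < 1, v(t) = t² − t³ + Σ_{m≥4} [2·(4(−1)^m m² + m² − 12(−1)^m m − 5m + 6(−1)^m + 6) / ((m−3)(m−2)(m−1)m)]·t^m, where the series converges. -/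
/-- The tail of the Mercator series of `log (1 - x)`, starting at exponent `j + 1`. -/
theorem hasSum_log_one_sub_tail {x : ℝ} (hx : |x| < 1) (j : ℕ) :
    HasSum (fun k : ℕ => x ^ (k + j + 1) / ((k : ℝ) + j + 1))
      (-Real.log (1 - x) - ∑ i ∈ Finset.range j, x ^ (i + 1) / ((i : ℝ) + 1)) := by
  simpa using (hasSum_nat_add_iff' j).mpr (Real.hasSum_pow_div_log_of_abs_lt_one hx)

theorem dipole_v_power_series
    (v : ℝ → ℝ)
    (hv : ∀ t : ℝ, v t =
      -t ^ 3 + 2 * t ^ 3 * Real.log (1 + t) + 3 * t ^ 2 - 2 * t ^ 2 * Real.log (1 + t)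
        - 2 * t * Real.log (1 - t) - 2 * t * Real.log (1 + t)
        + 2 * Real.log (1 - t) + 2 * Real.log (1 + t)) :
    ∀ t : ℝ, |t| < 1 →
      HasSum (fun k : ℕ =>
          (2 * (4 * (-1 : ℝ) ^ (k + 4) * ((k : ℝ) + 4) ^ 2 + ((k : ℝ) + 4) ^ 2
              - 12 * (-1 : ℝ) ^ (k + 4) * ((k : ℝ) + 4) - 5 * ((k : ℝ) + 4)
              + 6 * (-1 : ℝ) ^ (k + 4) + 6)
            / ((((k : ℝ) + 4) - 3) * (((k : ℝ) + 4) - 2) * (((k : ℝ) + 4) - 1) * ((k : ℝ) + 4)))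
            * t ^ (k + 4))
        (v t - (t ^ 2 - t ^ 3)) := by
  intro t ht
  have ht' : |-t| < 1 := by rwa [abs_neg]
  have plus (j : ℕ) := hasSum_log_one_sub_tail ht' j
  have minus (j : ℕ) := hasSum_log_one_sub_tail ht j
  convert! ((((plus 0).mul_left (-2 * t ^ 3)).add ((plus 1).mul_left (2 * t ^ 2))).add
    (((minus 2).mul_left (2 * t)).add ((plus 2).mul_left (2 * t)))).add
    (((minus 3).mul_left (-2)).add ((plus 3).mul_left (-2))) using 1
  · funext k
    have h1 : (k : ℝ) + 1 ≠ 0 := by positivity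
    have h2 : (k : ℝ) + 2 ≠ 0 := by positivity
    have h3 : (k : ℝ) + 3 ≠ 0 := by positivity
    have h4 : (k : ℝ) + 4 ≠ 0 := by positivity
    have e1 : (k : ℝ) + 4 - 3 = k + 1 := by ring
    have e2 : (k : ℝ) + 4 - 2 = k + 2 := by ring
    have e3 : (k : ℝ) + 4 - 1 = k + 3 := by ring
    have f1 : (k : ℝ) + (0 : ℕ) + 1 = k + 1 := by push_cast; ring
    have f2 : (k : ℝ) + (1 : ℕ) + 1 = k + 2 := by push_cast; ring
    have f3 : (k : ℝ) + (2 : ℕ) + 1 = k + 3 := by push_cast; ring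
    have f4 : (k : ℝ) + (3 : ℕ) + 1 = k + 4 := by push_cast; ring
    rw [e1, e2, e3, f1, f2, f3, f4]
    simp only [neg_pow t, pow_add]
    field_simp
    ring
  · rw [hv]
    simp only [Finset.sum_range_succ, Finset.sum_range_zero, sub_neg_eq_add]
    push_cast
    ring
end

section
/- Define f(m) = 4(−1)^m m² + m² − 12(−1)^m m − 5m + 6(−1)^m + 6 and S(n) = Σ_{m=4}^{n+1} f(m)/((m−3)(m−2)(m−1)m). Then n·(S(n) − 1 + 1/n) tends to 0 as n → ∞; equivalently, S(n) = 1 − 1/n + o(1/n). -/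
open Filter Finset

/-- Closed form of the partial sums, with the index shifted so that the sum is empty at `k = 0`. -/
theorem sum_dipole_coefficient (k : ℕ) :
    ∑ m ∈ Finset.Icc 4 (k + 3),
      (4 * (-1 : ℝ) ^ m * (m : ℝ) ^ 2 + (m : ℝ) ^ 2
        - 12 * (-1 : ℝ) ^ m * (m : ℝ) - 5 * (m : ℝ) + 6 * (-1 : ℝ) ^ m + 6)
        / (((m : ℝ) - 3) * ((m : ℝ) - 2) * ((m : ℝ) - 1) * (m : ℝ))
      = 1 - 1 / ((k : ℝ) + 3) - (-1 : ℝ) ^ k * 2 / (((k : ℝ) + 1) * ((k : ℝ) + 3)) := by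
  induction k with
  | zero => norm_num
  | succ k ih =>
    rw [show k + 1 + 3 = (k + 3) + 1 by ring, Finset.sum_Icc_succ_top (by omega), ih]
    have h1 : (k : ℝ) + 1 ≠ 0 := by positivity
    have h2 : (k : ℝ) + 2 ≠ 0 := by positivity
    have h3 : (k : ℝ) + 3 ≠ 0 := by positivity
    have h4 : (k : ℝ) + 4 ≠ 0 := by positivity
    push_cast
    rw [show (k : ℝ) + 3 + 1 - 3 = k + 1 by ring, show (k : ℝ) + 3 + 1 - 2 = k + 2 by ring,
      show (k : ℝ) + 3 + 1 - 1 = k + 3 by ring, show (k : ℝ) + 3 + 1 = k + 4 by ring,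
      show (k : ℝ) + 1 + 3 = k + 4 by ring, show (k : ℝ) + 1 + 1 = k + 2 by ring,
      show (-1 : ℝ) ^ (k + 3 + 1) = (-1) ^ k by ring, show (-1 : ℝ) ^ (k + 1) = -(-1) ^ k by ring]
    generalize (-1 : ℝ) ^ k = e
    field_simp
    ring

theorem dipole_coefficient_sum_asymptotic
    (f : ℕ → ℝ)
    (hf : ∀ m : ℕ, f m = 4 * (-1 : ℝ) ^ m * (m : ℝ) ^ 2 + (m : ℝ) ^ 2
      - 12 * (-1 : ℝ) ^ m * (m : ℝ) - 5 * (m : ℝ) + 6 * (-1 : ℝ) ^ m + 6)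
    (S : ℕ → ℝ)
    (hS : ∀ n : ℕ, S n = ∑ m ∈ Finset.Icc 4 (n + 1),
      f m / (((m : ℝ) - 3) * ((m : ℝ) - 2) * ((m : ℝ) - 1) * (m : ℝ))) :
    Tendsto (fun n : ℕ => (n : ℝ) * (S n - 1 + 1 / (n : ℝ))) atTop (nhds 0) := by
  rw [← tendsto_add_atTop_iff_nat 2]
  have hlim : Tendsto (fun k : ℕ => 3 * (1 / ((k : ℝ) + 1))) atTop (nhds 0) := by
    simpa using (tendsto_one_div_add_atTop_nhds_zero_nat (𝕜 := ℝ)).const_mul 3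
  refine squeeze_zero_norm (fun k => ?_) hlim
  have hk : (0 : ℝ) ≤ k := k.cast_nonneg
  have hclosed : ((k + 2 : ℕ) : ℝ) * (S (k + 2) - 1 + 1 / ((k + 2 : ℕ) : ℝ))
      = ((k + 1) - (-1 : ℝ) ^ k * (2 * (k + 2))) / (((k : ℝ) + 1) * (k + 3)) := by
    simp only [hS, hf]
    rw [sum_dipole_coefficient]
    push_cast
    field_simp
    ring
  rw [hclosed, Real.norm_eq_abs, abs_div, abs_of_pos (by positivity : 0 < ((k : ℝ) + 1) * (k + 3)),
    div_le_iff₀ (by positivity), show 3 * (1 / ((k : ℝ) + 1)) * ((k + 1) * (k + 3)) = 3 * (k + 3) by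
      field_simp, abs_le]
  rcases neg_one_pow_eq_or ℝ k with h | h <;> rw [h] <;> constructor <;> linarith
end

section
/- Define f(m) = 4(−1)^m m² + m² − 12(−1)^m m − 5m + 6(−1)^m + 6 and T(n) = Σ_{m=4}^{n+1} f(m)·(m−2)/((m−3)(m−2)(m−1)m). Then T(n) − ln n tends to c − 1 as n → ∞, where c is the Euler–Mascheroni constant. -/
open Filter Finset

/-- The weighted partial sum in closed form: partial fractions turn the alternating part into a
telescoping sum and the remaining part into a harmonic number. -/
theorem sum_dipole_weighted_coefficient (k : ℕ) :
    ∑ m ∈ Finset.Icc 4 (k + 3),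
      (4 * (-1 : ℝ) ^ m * (m : ℝ) ^ 2 + (m : ℝ) ^ 2
        - 12 * (-1 : ℝ) ^ m * (m : ℝ) - 5 * (m : ℝ) + 6 * (-1 : ℝ) ^ m + 6) * ((m : ℝ) - 2)
        / (((m : ℝ) - 3) * ((m : ℝ) - 2) * ((m : ℝ) - 1) * (m : ℝ))
      = (harmonic (k + 2) : ℝ) - 1 + 2 / ((k : ℝ) + 3)
        + (-1) ^ k * (-2 / ((k : ℝ) + 3) + 1 / ((k : ℝ) + 2) - 1 / ((k : ℝ) + 1)) := by
  induction k with
  | zero => norm_num [harmonic, Finset.sum_range_succ]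
  | succ k ih =>
    rw [show k + 1 + 3 = (k + 3) + 1 by ring, Finset.sum_Icc_succ_top (by omega), ih,
      show harmonic (k + 1 + 2) = _ from harmonic_succ (k + 2)]
    have h1 : (k : ℝ) + 1 ≠ 0 := by positivity
    have h2 : (k : ℝ) + 2 ≠ 0 := by positivity
    have h3 : (k : ℝ) + 3 ≠ 0 := by positivity
    have h4 : (k : ℝ) + 4 ≠ 0 := by positivity
    push_cast
    rw [show (k : ℝ) + 3 + 1 - 3 = k + 1 by ring, show (k : ℝ) + 3 + 1 - 2 = k + 2 by ring,
      show (k : ℝ) + 3 + 1 - 1 = k + 3 by ring, show (k : ℝ) + 3 + 1 = k + 4 by ring,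
      show (k : ℝ) + 1 + 3 = k + 4 by ring, show (k : ℝ) + 2 + 1 = k + 3 by ring,
      show (k : ℝ) + 1 + 2 = k + 3 by ring, show (k : ℝ) + 1 + 1 = k + 2 by ring,
      show (-1 : ℝ) ^ (k + 3 + 1) = (-1) ^ k by ring, show (-1 : ℝ) ^ (k + 1) = -(-1) ^ k by ring]
    generalize (-1 : ℝ) ^ k = s
    field_simp
    ring

theorem dipole_weighted_coefficient_sum_asymptotic
    (f : ℕ → ℝ)
    (hf : ∀ m : ℕ, f m = 4 * (-1 : ℝ) ^ m * (m : ℝ) ^ 2 + (m : ℝ) ^ 2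
      - 12 * (-1 : ℝ) ^ m * (m : ℝ) - 5 * (m : ℝ) + 6 * (-1 : ℝ) ^ m + 6)
    (T : ℕ → ℝ)
    (hT : ∀ n : ℕ, T n = ∑ m ∈ Finset.Icc 4 (n + 1),
      f m * ((m : ℝ) - 2) / (((m : ℝ) - 3) * ((m : ℝ) - 2) * ((m : ℝ) - 1) * (m : ℝ))) :
    Tendsto (fun n : ℕ => T n - Real.log n) atTop
      (nhds (Real.eulerMascheroniConstant - 1)) := by
  have hinv (a c : ℝ) : Tendsto (fun k : ℕ => a / ((k : ℝ) + c)) atTop (nhds 0) :=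
    (tendsto_atTop_add_const_right _ c tendsto_natCast_atTop_atTop).const_div_atTop a
  have halt : Tendsto (fun k : ℕ => (-1 : ℝ) ^ k *
      (-2 / ((k : ℝ) + 3) + 1 / ((k : ℝ) + 2) - 1 / ((k : ℝ) + 1))) atTop (nhds 0) := by
    refine squeeze_zero_norm (fun k => ?_)
      (by simpa using (((hinv (-2) 3).add (hinv 1 2)).sub (hinv 1 1)).norm)
    simp
  have hharm := (tendsto_add_atTop_iff_nat 2).2 Real.tendsto_harmonic_sub_log
  rw [← tendsto_add_atTop_iff_nat 2]
  have hlim := ((hharm.sub_const 1).add (hinv 2 3)).add halt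
  rw [add_zero, add_zero] at hlim
  refine hlim.congr fun k => ?_
  simp only [hT, hf]
  rw [show k + 2 + 1 = k + 3 by ring, sum_dipole_weighted_coefficient]
  ring
end

section
/- Define f(m) = 4(−1)^m m² − 12(−1)^m m + 6(−1)^m − 5m + 6. Then the sums Σ_{m=4}^{n+1} f(m)·(m−2)/((m−3)(m−2)(m−1)m) converge to −7/4 as n → ∞. -/
open Filter Finset

/-- Closed form of the partial sums, obtained by partial fractions and telescoping. -/
lemma sum_Icc_reduced_coefficient (k : ℕ) :
    ∑ m ∈ Finset.Icc 4 (k + 3),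
        (4 * (-1 : ℝ) ^ m * (m : ℝ) ^ 2 - 12 * (-1 : ℝ) ^ m * (m : ℝ)
          + 6 * (-1 : ℝ) ^ m - 5 * (m : ℝ) + 6) * ((m : ℝ) - 2)
          / (((m : ℝ) - 3) * ((m : ℝ) - 2) * ((m : ℝ) - 1) * (m : ℝ))
      = (2 - 2 * (-1 : ℝ) ^ k) / ((k : ℝ) + 3) + (3 / 2 + (-1 : ℝ) ^ k) / ((k : ℝ) + 2)
        + (3 / 2 - (-1 : ℝ) ^ k) / ((k : ℝ) + 1) - 7 / 4 := by
  induction k with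
  | zero => norm_num
  | succ k ih =>
    rw [show k + 1 + 3 = k + 3 + 1 by ring, Finset.sum_Icc_succ_top (by omega), ih]
    have hpow : (-1 : ℝ) ^ (k + 3 + 1) = (-1) ^ k := by ring
    rw [hpow, pow_succ (-1 : ℝ) k]
    push_cast
    generalize (-1 : ℝ) ^ k = e
    have h₁ : (k : ℝ) + 1 ≠ 0 := by positivity
    have h₂ : (k : ℝ) + 2 ≠ 0 := by positivity
    have h₃ : (k : ℝ) + 3 ≠ 0 := by positivity
    have h₄ : (k : ℝ) + 4 ≠ 0 := by positivity
    rw [show (k : ℝ) + 3 + 1 - 3 = k + 1 by ring, show (k : ℝ) + 3 + 1 - 2 = k + 2 by ring,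
      show (k : ℝ) + 3 + 1 - 1 = k + 3 by ring, show (k : ℝ) + 3 + 1 = k + 4 by ring,
      show (k : ℝ) + 1 + 3 = k + 4 by ring, show (k : ℝ) + 1 + 2 = k + 3 by ring,
      show (k : ℝ) + 1 + 1 = k + 2 by ring]
    field_simp
    ring

/-- An affine function of the alternating sign, divided by a shifted index, tends to zero. -/
lemma tendsto_alternating_div_add_atTop (a b c : ℝ) :
    Tendsto (fun k : ℕ => (a + b * (-1 : ℝ) ^ k) / ((k : ℝ) + c)) atTop (nhds 0) := by
  refine tendsto_bdd_div_atTop_nhds_zero (b := a - |b|) (B := a + |b|) ?_ ?_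
    (tendsto_atTop_add_const_right _ c tendsto_natCast_atTop_atTop)
  all_goals
    refine Eventually.of_forall fun k => ?_
    rcases neg_one_pow_eq_or ℝ k with h | h <;> rw [h] <;>
      linarith [le_abs_self b, neg_abs_le b]

theorem dipole_reduced_coefficient_sum_limit
    (f : ℕ → ℝ)
    (hf : ∀ m : ℕ, f m = 4 * (-1 : ℝ) ^ m * (m : ℝ) ^ 2 - 12 * (-1 : ℝ) ^ m * (m : ℝ)
      + 6 * (-1 : ℝ) ^ m - 5 * (m : ℝ) + 6) :
    Tendsto (fun n : ℕ => ∑ m ∈ Finset.Icc 4 (n + 1),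
        f m * ((m : ℝ) - 2) / (((m : ℝ) - 3) * ((m : ℝ) - 2) * ((m : ℝ) - 1) * (m : ℝ)))
      atTop (nhds (-7/4)) := by
  rw [← tendsto_add_atTop_iff_nat 2]
  simp only [hf, Nat.add_assoc, Nat.reduceAdd, sum_Icc_reduced_coefficient]
  have h := (((tendsto_alternating_div_add_atTop 2 (-2) 3).add
    (tendsto_alternating_div_add_atTop (3 / 2) 1 2)).add
    (tendsto_alternating_div_add_atTop (3 / 2) (-1) 1)).sub_const (7 / 4)
  convert h using 2
  · ring
  · norm_num
end

section
/- Let s : ℕ → ℝ satisfy s(1) = 1, s(2) = 1, and (n+2)·s(n+1) = n(2n+1)·s(n) + n(n−1)²(n²−1)·s(n−1) for all n ≥ 2. Then s(n) = ((n−1)!)² for all n ≥ 1. -/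
theorem dipole_total_embeddings
    (s : ℕ → ℝ) (hs1 : s 1 = 1) (hs2 : s 2 = 1)
    (hrec : ∀ n : ℕ, 2 ≤ n →
      ((n : ℝ) + 2) * s (n + 1)
        = (n : ℝ) * (2 * (n : ℝ) + 1) * s n
          + (n : ℝ) * ((n : ℝ) - 1) ^ 2 * ((n : ℝ) ^ 2 - 1) * s (n - 1)) :
    ∀ n : ℕ, 1 ≤ n → s n = (((n - 1).factorial : ℝ)) ^ 2 := by
  have key : ∀ k : ℕ, s (k + 1) = (k.factorial : ℝ) ^ 2 ∧
      s (k + 2) = ((k + 1).factorial : ℝ) ^ 2 := by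
    intro k
    induction k with
    | zero => simp [hs1, hs2]
    | succ k ih =>
      obtain ⟨h₁, h₂⟩ := ih
      refine ⟨h₂, ?_⟩
      have h := hrec (k + 2) (by omega)
      rw [show k + 2 - 1 = k + 1 by omega, h₁, h₂] at h
      have hpos : ((k + 2 : ℕ) : ℝ) + 2 ≠ 0 := by positivity
      apply mul_left_cancel₀ hpos
      rw [show k + 1 + 2 = k + 2 + 1 by omega, h]
      simp only [Nat.factorial_succ]
      push_cast
      ring
  intro n hn
  obtain ⟨k, rfl⟩ := Nat.exists_eq_add_of_le' hn
  simpa using (key k).1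
end

section
/- Let P : ℕ → ℝ[X] be a sequence of real polynomials with P(1) = 1, P(2) = 4 + 2X, satisfying (n+1)·P(n) = 4(2n−1)(2n−3)(n−1)²(n−2)·X·P(n−2) + 4(2n−1)(n−1)·P(n−1) for all n ≥ 3, and suppose P(n) evaluated at 1 equals (2n−1)! for all n ≥ 1. Define a(n) = P(n)'(1)/(2n−1)!, where P(n)' is the formal derivative. Then (n+1)·a(n) = 2·a(n−1) + (n−1)·(a(n−2) + 1) for all n ≥ 3. -/
open Polynomial

theorem bouquet_genus_polynomial_to_average_genus_recurrence
    (P : ℕ → ℝ[X]) (hP1 : P 1 = 1) (hP2 : P 2 = C 4 + C 2 * X)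
    (hrec : ∀ n : ℕ, 3 ≤ n →
      C ((n : ℝ) + 1) * P n
        = C (4 * (2 * (n : ℝ) - 1) * (2 * (n : ℝ) - 3) * ((n : ℝ) - 1) ^ 2 * ((n : ℝ) - 2))
            * X * P (n - 2)
          + C (4 * (2 * (n : ℝ) - 1) * ((n : ℝ) - 1)) * P (n - 1))
    (heval : ∀ n : ℕ, 1 ≤ n → (P n).eval 1 = ((2 * n - 1).factorial : ℝ))
    (a : ℕ → ℝ)
    (ha : ∀ n : ℕ, a n = (derivative (P n)).eval 1 / ((2 * n - 1).factorial : ℝ)) :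
    ∀ n : ℕ, 3 ≤ n →
      ((n : ℝ) + 1) * a n = 2 * a (n - 1) + ((n : ℝ) - 1) * (a (n - 2) + 1) := by
  intro n hn
  obtain ⟨m, rfl⟩ := Nat.exists_eq_add_of_le' hn
  have hder := congrArg (fun p : ℝ[X] => (derivative p).eval 1) (hrec (m + 3) hn)
  have hval := heval (m + 1) (by omega)
  have ha₁ := ha (m + 1)
  have ha₂ := ha (m + 2)
  have ha₃ := ha (m + 3)
  simp only [show m + 3 - 2 = m + 1 by omega, show m + 3 - 1 = m + 2 by omega] at hder ⊢
  simp only [derivative_add, derivative_mul, derivative_C, derivative_X, eval_add, eval_mul,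
    eval_C, eval_X, eval_one, eval_zero] at hder
  rw [show 2 * (m + 1) - 1 = 2 * m + 1 by omega] at hval ha₁
  rw [show 2 * (m + 2) - 1 = 2 * m + 1 + 1 + 1 by omega] at ha₂
  rw [show 2 * (m + 3) - 1 = 2 * m + 1 + 1 + 1 + 1 + 1 by omega] at ha₃
  simp only [Nat.factorial_succ (2 * m + 1 + 1 + 1 + 1), Nat.factorial_succ (2 * m + 1 + 1 + 1),
    Nat.factorial_succ (2 * m + 1 + 1), Nat.factorial_succ (2 * m + 1)] at ha₂ ha₃
  have hF : ((2 * m + 1).factorial : ℝ) ≠ 0 := by positivity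
  rw [hval] at hder
  generalize ((2 * m + 1).factorial) = F at *
  push_cast at *
  have hm : (0 : ℝ) ≤ m := Nat.cast_nonneg m
  rw [eq_div_iff (by positivity)] at ha₁ ha₂ ha₃
  rw [← ha₁, ← ha₂, ← ha₃] at hder
  have hK : (2 * (m : ℝ) + 5) * (2 * m + 4) * (2 * m + 3) * (2 * m + 2) * F ≠ 0 := by positivity
  apply mul_left_cancel₀ hK
  linear_combination hder
end

section
/- Let Q : ℕ → ℝ[X] be a sequence of real polynomials with Q(1) = 1, Q(2) = 1, satisfying (n+2)·Q(n+1) − n(2n+1)·Q(n) = n(n−1)²·(n²·X − 1)·Q(n−1) for all n ≥ 2, and suppose Q(n) evaluated at 1 equals ((n−1)!)² for all n ≥ 1. Define a(n) = Q(n)'(1)/((n−1)!)², where Q(n)' is the formal derivative. Then n(n+2)·a(n+1) = (2n+1)·a(n) + (n²−1)·a(n−1) + n² for all n ≥ 2. -/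
open Polynomial

theorem dipole_genus_polynomial_to_average_genus_recurrence
    (Q : ℕ → ℝ[X]) (hQ1 : Q 1 = 1) (hQ2 : Q 2 = 1)
    (hrec : ∀ n : ℕ, 2 ≤ n →
      C ((n : ℝ) + 2) * Q (n + 1) - C ((n : ℝ) * (2 * (n : ℝ) + 1)) * Q n
        = C ((n : ℝ) * ((n : ℝ) - 1) ^ 2) * (C ((n : ℝ) ^ 2) * X - 1) * Q (n - 1))
    (heval : ∀ n : ℕ, 1 ≤ n → (Q n).eval 1 = (((n - 1).factorial : ℝ)) ^ 2)
    (a : ℕ → ℝ)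
    (ha : ∀ n : ℕ, a n = (derivative (Q n)).eval 1 / (((n - 1).factorial : ℝ)) ^ 2) :
    ∀ n : ℕ, 2 ≤ n →
      (n : ℝ) * ((n : ℝ) + 2) * a (n + 1)
        = (2 * (n : ℝ) + 1) * a n + ((n : ℝ) ^ 2 - 1) * a (n - 1) + (n : ℝ) ^ 2 := by
  intro n hn
  have hderiv (k : ℕ) :
      (derivative (Q k)).eval 1 = a k * ((k - 1).factorial : ℝ) ^ 2 := by
    rw [ha k, div_mul_cancel₀ _ (pow_ne_zero 2 (Nat.cast_ne_zero.mpr (Nat.factorial_ne_zero _)))]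
  have hdiff := congrArg (fun p => (derivative p).eval 1) (hrec n hn)
  obtain ⟨m, rfl⟩ := Nat.exists_eq_add_of_le' hn
  have hpred : m + 2 - 1 = m + 1 := rfl
  simp only [derivative_sub, derivative_mul, derivative_C, derivative_X, derivative_one,
    eval_sub, eval_add, eval_mul, eval_C, eval_X, eval_one, eval_zero, hpred, hderiv,
    heval (m + 1) (Nat.le_add_left 1 m), Nat.add_sub_cancel, Nat.factorial_succ] at hdiff ⊢
  push_cast at hdiff ⊢
  have hfactor : ((m : ℝ) + 2) * ((m : ℝ) + 1) ^ 2 * (m.factorial : ℝ) ^ 2 ≠ 0 := by positivity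
  apply mul_left_cancel₀ hfactor
  linear_combination hdiff
end
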